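/- arXiv:2301.05066 — 2 statements merged into one kernel-verified Lean document; each statement's English description precedes it below -/
import Mathlib

section
/- For every m ≥ 1 and all indices j, k ∈ {1,…,m}, the operators Y_{jk} := x_j∂_{y_k} + x_k∂_{y_j} − ∂_{z_j}∂_{z_k} and Z_{jk} := y_j∂_{x_k} + y_k∂_{x_j} + (multiplication by z_j z_k) both commute with the adjoint symplectic operator: [X_s, Y_{jk}] = 0 and [X_s, Z_{jk}] = 0. -/
open MvPolynomial Finset

noncomputable section

/-- Polynomials in 3m variables x_1..x_m, y_1..y_m, z_1..z_m. -/
abbrev PS (m : ℕ) : Type := MvPolynomial (Fin m ⊕ Fin m ⊕ Fin m) ℂ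

variable (m : ℕ)

/-- partial derivative ∂_{x_j} -/
def dx (j : Fin m) : Module.End ℂ (PS m) := (pderiv (Sum.inl j)).toLinearMap
/-- partial derivative ∂_{y_j} -/
def dy (j : Fin m) : Module.End ℂ (PS m) := (pderiv (Sum.inr (Sum.inl j))).toLinearMap
/-- partial derivative ∂_{z_j} -/
def dz (j : Fin m) : Module.End ℂ (PS m) := (pderiv (Sum.inr (Sum.inr j))).toLinearMap
/-- multiplication by x_j -/
def mx (j : Fin m) : Module.End ℂ (PS m) := LinearMap.mulLeft ℂ (X (Sum.inl j))
/-- multiplication by y_j -/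
def my (j : Fin m) : Module.End ℂ (PS m) := LinearMap.mulLeft ℂ (X (Sum.inr (Sum.inl j)))
/-- multiplication by z_j -/
def mz (j : Fin m) : Module.End ℂ (PS m) := LinearMap.mulLeft ℂ (X (Sum.inr (Sum.inr j)))

/-- symplectic Dirac operator D_s = ⟨z,∂_y⟩ − ⟨∂_z,∂_x⟩ -/
def Ds : Module.End ℂ (PS m) := (∑ j, mz m j * dy m j) - ∑ j, dz m j * dx m j
/-- adjoint X_s = ⟨y,∂_z⟩ + ⟨x,z⟩ -/
def Xs : Module.End ℂ (PS m) := (∑ j, my m j * dz m j) + ∑ j, mx m j * mz m j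
/-- Euler operator in x -/
def Ex : Module.End ℂ (PS m) := ∑ j, mx m j * dx m j
/-- Euler operator in y -/
def Ey : Module.End ℂ (PS m) := ∑ j, my m j * dy m j
/-- Euler operator in z -/
def Ez : Module.End ℂ (PS m) := ∑ j, mz m j * dz m j
/-- Δ_x -/
def lapX : Module.End ℂ (PS m) := ∑ j, dx m j * dx m j
/-- Δ_y -/
def lapY : Module.End ℂ (PS m) := ∑ j, dy m j * dy m j
/-- Δ_z -/
def lapZ : Module.End ℂ (PS m) := ∑ j, dz m j * dz m j
/-- ⟨∂_x,∂_y⟩ -/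
def dxdy : Module.End ℂ (PS m) := ∑ j, dx m j * dy m j
/-- ⟨∂_y,∂_z⟩ -/
def dydz : Module.End ℂ (PS m) := ∑ j, dy m j * dz m j
/-- ⟨∂_x,∂_z⟩ = ⟨∂_z,∂_x⟩ -/
def dxdz : Module.End ℂ (PS m) := ∑ j, dx m j * dz m j
/-- ⟨x,∂_y⟩ -/
def xdy : Module.End ℂ (PS m) := ∑ j, mx m j * dy m j
/-- ⟨y,∂_x⟩ -/
def ydx : Module.End ℂ (PS m) := ∑ j, my m j * dx m j
/-- ⟨x,∂_z⟩ -/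
def xdz : Module.End ℂ (PS m) := ∑ j, mx m j * dz m j
/-- ⟨z,∂_x⟩ -/
def zdx : Module.End ℂ (PS m) := ∑ j, mz m j * dx m j
/-- ⟨y,∂_z⟩ -/
def ydz : Module.End ℂ (PS m) := ∑ j, my m j * dz m j
/-- ⟨z,∂_y⟩ -/
def zdy : Module.End ℂ (PS m) := ∑ j, mz m j * dy m j
/-- multiplication by |x|² -/
def nx2 : Module.End ℂ (PS m) := ∑ j, mx m j * mx m j
/-- multiplication by |y|² -/
def ny2 : Module.End ℂ (PS m) := ∑ j, my m j * my m j
/-- multiplication by |z|² -/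
def nz2 : Module.End ℂ (PS m) := ∑ j, mz m j * mz m j
/-- multiplication by ⟨x,y⟩ -/
def mxy : Module.End ℂ (PS m) := ∑ j, mx m j * my m j
/-- multiplication by ⟨y,z⟩ -/
def myz : Module.End ℂ (PS m) := ∑ j, my m j * mz m j
/-- multiplication by ⟨x,z⟩ -/
def mxz : Module.End ℂ (PS m) := ∑ j, mx m j * mz m j
/-- L = ⟨x,∂_y⟩ − (1/2)Δ_z -/
def Lop : Module.End ℂ (PS m) := xdy m - (1/2 : ℂ) • lapZ m
/-- R = ⟨y,∂_x⟩ + (1/2)|z|² -/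
def Rop : Module.End ℂ (PS m) := ydx m + (1/2 : ℂ) • nz2 m

/-- Y_{jk} := x_j∂_{y_k} + x_k∂_{y_j} − ∂_{z_j}∂_{z_k} -/
def Yjk (j k : Fin m) : Module.End ℂ (PS m) :=
  mx m j * dy m k + mx m k * dy m j - dz m j * dz m k

/-- Z_{jk} := y_j∂_{x_k} + y_k∂_{x_j} + z_j z_k -/
def Zjk (j k : Fin m) : Module.End ℂ (PS m) :=
  my m j * dx m k + my m k * dx m j + mz m j * mz m k

theorem pderiv_pderiv_comm {σ R : Type*} [CommRing R] (i j : σ) (p : MvPolynomial σ R) :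
    pderiv i (pderiv j p) = pderiv j (pderiv i p) := by
  classical
  have h : ⁅(pderiv i : Derivation R (MvPolynomial σ R) (MvPolynomial σ R)),
      (pderiv j : Derivation R (MvPolynomial σ R) (MvPolynomial σ R))⁆ = 0 := by
    ext k
    simp [Derivation.commutator_apply, pderiv_X, Pi.single_apply, apply_ite]
  simpa [Derivation.commutator_apply, sub_eq_zero] using DFunLike.congr_fun h p

theorem Xs_apply (p : PS m) :
    Xs m p = (∑ i, X (Sum.inr (Sum.inl i)) * pderiv (Sum.inr (Sum.inr i)) p) +
      (∑ i, X (Sum.inl i) * X (Sum.inr (Sum.inr i))) * p := by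
  simp [Xs, my, mx, dz, mz, Finset.sum_mul, mul_assoc]

theorem pderiv_Xs (s : Fin m ⊕ Fin m ⊕ Fin m) (p : PS m) :
    pderiv s (Xs m p) = Xs m (pderiv s p) +
      ((∑ i, pderiv s (X (Sum.inr (Sum.inl i))) * pderiv (Sum.inr (Sum.inr i)) p) +
      (∑ i, pderiv s (X (Sum.inl i) * X (Sum.inr (Sum.inr i)))) * p) := by
  have h (i : Fin m) : pderiv s (pderiv (Sum.inr (Sum.inr i)) p) =
      pderiv (Sum.inr (Sum.inr i)) (pderiv s p) := pderiv_pderiv_comm _ _ _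
  rw [Xs_apply, Xs_apply, map_add, map_sum, Derivation.leibniz, map_sum]
  simp only [Derivation.leibniz (pderiv s) (X (Sum.inr (Sum.inl _))) , h, Finset.sum_add_distrib,
    smul_eq_mul]
  simp only [mul_comm]
  ring

theorem Xs_mul (q p : PS m) :
    Xs m (q * p) = q * Xs m p +
      (∑ i, X (Sum.inr (Sum.inl i)) * pderiv (Sum.inr (Sum.inr i)) q) * p := by
  simp only [Xs_apply, Derivation.leibniz, smul_eq_mul, mul_add, Finset.sum_add_distrib,
    Finset.mul_sum, Finset.sum_mul]
  simp only [mul_comm, mul_left_comm, mul_assoc]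
  ring

/-- [X_s, Y_{jk}] = 0 and [X_s, Z_{jk}] = 0. -/
theorem stmt6 : ∀ m : ℕ, 1 ≤ m → ∀ j k : Fin m,
    ⁅Xs m, Yjk m j k⁆ = 0 ∧ ⁅Xs m, Zjk m j k⁆ = 0 := by
  intro m _ j k
  constructor <;> refine LinearMap.ext fun p => ?_
  · simp [Ring.lie_def, Yjk, mx, dy, dz, pderiv_Xs, Xs_mul, pderiv_X, Pi.single_apply]
    ring
  · simp [Ring.lie_def, Zjk, my, dx, mz, pderiv_Xs, Xs_mul, pderiv_X, Pi.single_apply]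
    ring
end
end

section
/- For every m ≥ 1 and every complex polynomial P in the variables x_1,…,x_m, y_1,…,y_m, z_1,…,z_m, the following are equivalent: (1) P is annihilated by D_s, by L, and by the seven operators Δ_y, ⟨∂_x,∂_y⟩, Δ_x, ⟨∂_y,∂_z⟩, ⟨z,∂_y⟩+⟨∂_x,∂_z⟩, ⟨z,∂_x⟩, ⟨x,∂_y⟩+Δ_z; (2) P is simplicial harmonic, i.e. P is annihilated by each of the nine operators Δ_x, Δ_y, Δ_z, ⟨∂_x,∂_y⟩, ⟨∂_y,∂_z⟩, ⟨∂_x,∂_z⟩, ⟨z,∂_x⟩, ⟨z,∂_y⟩, ⟨x,∂_y⟩. -/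
open MvPolynomial Finset

noncomputable section

variable (m : ℕ)

theorem pderiv_comm_apply {R σ : Type*} [CommRing R] (i j : σ) (p : MvPolynomial σ R) :
    pderiv i (pderiv j p) = pderiv j (pderiv i p) := by
  have h : ⁅pderiv (R := R) i, pderiv (R := R) j⁆ = 0 := by
    classical
    refine derivation_ext fun k => ?_
    simp [Derivation.commutator_apply, pderiv_X, Pi.single_apply, apply_ite]
  rw [← sub_eq_zero, ← Derivation.commutator_apply, h, Derivation.zero_apply]

theorem dz_mul_dx (j : Fin m) : dz m j * dx m j = dx m j * dz m j :=
  LinearMap.ext fun p => pderiv_comm_apply _ _ p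

theorem Ds_eq_zdy_sub_dxdz : Ds m = zdy m - dxdz m := by
  simp only [Ds, zdy, dxdz, dz_mul_dx]

/-- a polynomial is annihilated by D_s, L and the seven listed operators
iff it is simplicial harmonic (annihilated by the nine listed operators). -/
theorem stmt17 : ∀ m : ℕ, 1 ≤ m → ∀ p : PS m,
    (Ds m p = 0 ∧ Lop m p = 0 ∧
      lapY m p = 0 ∧ dxdy m p = 0 ∧ lapX m p = 0 ∧ dydz m p = 0 ∧
      (zdy m + dxdz m) p = 0 ∧ zdx m p = 0 ∧ (xdy m + lapZ m) p = 0) ↔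
    (lapX m p = 0 ∧ lapY m p = 0 ∧ lapZ m p = 0 ∧
      dxdy m p = 0 ∧ dydz m p = 0 ∧ dxdz m p = 0 ∧
      zdx m p = 0 ∧ zdy m p = 0 ∧ xdy m p = 0) := by
  intro m _ p
  simp only [Ds_eq_zdy_sub_dxdz, Lop, LinearMap.sub_apply, LinearMap.add_apply,
    LinearMap.smul_apply]
  constructor
  · rintro ⟨hD, hL, hyy, hxy, hxx, hyz, hA, hzx, hB⟩
    have hxz : dxdz m p = 0 := by
      have h : (2 : ℂ) • dxdz m p = 0 := by
        linear_combination (norm := module) hA - hD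
      exact (smul_eq_zero.mp h).resolve_left (by norm_num)
    have hzz : lapZ m p = 0 := by
      have h : (3 / 2 : ℂ) • lapZ m p = 0 := by
        linear_combination (norm := module) hB - hL
      exact (smul_eq_zero.mp h).resolve_left (by norm_num)
    rw [hxz, add_zero] at hA
    rw [hzz, add_zero] at hB
    exact ⟨hxx, hyy, hzz, hxy, hyz, hxz, hzx, hA, hB⟩
  · rintro ⟨hxx, hyy, hzz, hxy, hyz, hxz, hzx, hzy, hxdy⟩
    simp [*]
end
end
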